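/- arXiv:math/0404236 — 4 statements merged into one kernel-verified Lean document; each statement's English description precedes it below -/
import Mathlib

section
/- Fix integers k ≥ 1 and n ≥ 1, and let p_n(t) = (t²+t+1)·(t^{2k+2}+t)^n + t·(t^{2k+2}−t²−t−1)^n ∈ ℤ[t]. Then (1+t)^{n+1} divides p_n(t) in ℤ[t]. -/
open Polynomial

/-- For `k ≥ 1` and `n ≥ 1`, the polynomial
`p_n(t) = (t²+t+1)(t^{2k+2}+t)^n + t(t^{2k+2}−t²−t−1)^n` is divisible by `(1+t)^{n+1}`
in `ℤ[t]`. -/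
theorem one_add_X_pow_dvd_pretzel (k n : ℕ) (hk : 1 ≤ k) (hn : 1 ≤ n) :
    (1 + X) ^ (n + 1) ∣
      ((X ^ 2 + X + 1) * (X ^ (2 * k + 2) + X) ^ n
        + X * (X ^ (2 * k + 2) - X ^ 2 - X - 1) ^ n : Polynomial ℤ) := by
  obtain ⟨b, hb⟩ : (1 + X : ℤ[X]) ∣ 1 ^ (2 * k + 1) + X ^ (2 * k + 1) :=
    Odd.add_dvd_pow_add_pow 1 X ⟨k, rfl⟩
  have hA : (X ^ (2 * k + 2) + X : ℤ[X]) = (1 + X) * (X * b) := by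
    linear_combination X * hb + X * one_pow (M := ℤ[X]) (2 * k + 1)
  have hB : (X ^ (2 * k + 2) - X ^ 2 - X - 1 : ℤ[X]) = (1 + X) * (X * b - (1 + X)) := by
    linear_combination hA
  obtain ⟨c, hc⟩ := sub_dvd_pow_sub_pow (X * b) (X * b - (1 + X)) n
  rw [hA, hB, mul_pow (1 + X), mul_pow (1 + X), pow_succ]
  generalize (X * b - (1 + X)) ^ n = v at hc ⊢
  exact ⟨(1 + X) * (X * b) ^ n - X * c, by linear_combination -(1 + X) ^ n * X * hc⟩
end

section
/- Let f be a polynomial with integer coefficients such that f(0) ≠ 0. If the sum of the absolute values of the coefficients of f is at most M, and f has at most k distinct complex roots, then deg(f) ≤ k(M−1). -/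
open Polynomial

namespace Polynomial

theorem card_support_divX_le {R : Type*} [Semiring R] (p : R[X]) :
    p.divX.support.card ≤ p.support.card :=
  Finset.card_le_card_of_injOn (· + 1) (fun i hi ↦ by simpa [coeff_divX, add_comm] using hi)
    (add_left_injective 1).injOn

theorem card_support_derivative_lt {R : Type*} [Semiring R] {p : R[X]} (h : p.coeff 0 ≠ 0) :
    (derivative p).support.card < p.support.card := by
  rw [← Finset.card_erase_add_one (mem_support_iff.mpr h), Nat.lt_succ_iff]
  refine Finset.card_le_card_of_injOn (· + 1) (fun i hi ↦ ?_) (add_left_injective 1).injOn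
  have hi' := mem_support_iff.mp hi
  rw [coeff_derivative] at hi'
  simpa using left_ne_zero_of_mul hi'

/-- A nonzero polynomial with a nonzero root of multiplicity at least `n` has more than `n`
nonzero coefficients. -/
theorem lt_card_support_of_X_sub_C_pow_dvd {K : Type*} [Field K] [CharZero K] {p : K[X]}
    (hp : p ≠ 0) {a : K} (ha : a ≠ 0) {n : ℕ} (h : (X - C a) ^ n ∣ p) :
    n < p.support.card := by
  induction hd : p.natDegree using Nat.strong_induction_on generalizing p n with
  | _ d ih =>
    subst hd
    rcases Nat.eq_zero_or_pos n with rfl | hn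
    · simpa [Finset.card_pos, Finset.nonempty_iff_ne_empty] using hp
    have hdeg : n ≤ p.natDegree := by
      simpa using natDegree_le_of_dvd h hp
    by_cases h0 : p.coeff 0 = 0
    · have hpX : p = p.divX * X := by
        simpa [h0] using (divX_mul_X_add p).symm
      have hq : p.divX ≠ 0 := fun hq ↦ hp (by rw [hpX, hq, zero_mul])
      have hcop : IsCoprime ((X - C a) ^ n) (X : K[X]) := by
        have := (isCoprime_X_sub_C_of_isUnit_sub (a := a) (b := 0)
          (by simpa using ha)).pow_left (m := n)
        simpa using this
      have hdvd : (X - C a) ^ n ∣ p.divX := hcop.dvd_of_dvd_mul_right (hpX ▸ h)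
      have hlt : p.divX.natDegree < p.natDegree := by
        rw [natDegree_divX_eq_natDegree_tsub_one]
        omega
      exact (ih _ hlt hq hdvd rfl).trans_le p.card_support_divX_le
    · have hlt : (derivative p).natDegree < p.natDegree := natDegree_derivative_lt (by omega)
      have hq : derivative p ≠ 0 := fun hq ↦ by
        have := derivative_eq_zero.mp hq
        omega
      have := ih _ hlt hq (pow_sub_one_dvd_derivative_of_pow_dvd h) rfl
      have := card_support_derivative_lt h0
      omega

theorem card_support_le_sum_abs_coeff (f : ℤ[X]) :
    (f.support.card : ℤ) ≤ ∑ i ∈ Finset.range (f.natDegree + 1), |f.coeff i| :=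
  calc (f.support.card : ℤ) = ∑ _i ∈ f.support, 1 := by simp
    _ ≤ ∑ i ∈ f.support, |f.coeff i| :=
      Finset.sum_le_sum fun i hi ↦ Int.one_le_abs (mem_support_iff.mp hi)
    _ ≤ ∑ i ∈ Finset.range (f.natDegree + 1), |f.coeff i| :=
      Finset.sum_le_sum_of_subset_of_nonneg supp_subset_range_natDegree_succ
        fun _ _ _ ↦ abs_nonneg _

end Polynomial

/-- If `f ∈ ℤ[t]` has `f(0) ≠ 0`, the sum of the absolute values of its coefficients is
at most `M`, and `f` has at most `k` distinct complex roots, then `deg f ≤ k(M−1)`. -/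
theorem natDegree_le_of_L1_norm_and_distinct_roots (f : Polynomial ℤ) (hf : f.eval 0 ≠ 0)
    (M : ℤ) (k : ℕ)
    (hM : ∑ i ∈ Finset.range (f.natDegree + 1), |f.coeff i| ≤ M)
    (hk : (f.map (Int.castRingHom ℂ)).roots.toFinset.card ≤ k) :
    (f.natDegree : ℤ) ≤ k * (M - 1) := by
  have hinj : Function.Injective (Int.castRingHom ℂ) := Int.cast_injective
  have hf0 : f ≠ 0 := by rintro rfl; simp at hf
  set g := f.map (Int.castRingHom ℂ) with hg
  have hg0 : g ≠ 0 := (Polynomial.map_ne_zero_iff hinj).mpr hf0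
  have hsupp : g.support = f.support := support_map_of_injective f hinj
  have hcard : (f.support.card : ℤ) ≤ M := f.card_support_le_sum_abs_coeff.trans hM
  have hpos : 0 < f.support.card := Finset.card_pos.mpr (support_nonempty.mpr hf0)
  have hcount : ∀ a ∈ g.roots.toFinset, (g.roots.count a : ℤ) ≤ M - 1 := by
    intro a ha
    have ha0 : a ≠ 0 := by
      rintro rfl
      have hroot : g.eval 0 = 0 := (mem_roots hg0).mp (Multiset.mem_toFinset.mp ha)
      rw [← coeff_zero_eq_eval_zero, hg, coeff_map, ← map_zero (Int.castRingHom ℂ)] at hroot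
      exact hf (by rw [← coeff_zero_eq_eval_zero]; exact hinj hroot)
    have := lt_card_support_of_X_sub_C_pow_dvd hg0 ha0 (pow_rootMultiplicity_dvd g a)
    rw [count_roots]
    rw [hsupp] at this
    omega
  calc (f.natDegree : ℤ) = g.roots.card := by
        rw [← (IsAlgClosed.splits g).natDegree_eq_card_roots, hg,
          natDegree_map_eq_of_injective hinj]
    _ = ∑ a ∈ g.roots.toFinset, (g.roots.count a : ℤ) := by
        rw [← Multiset.toFinset_sum_count_eq, Nat.cast_sum]
    _ ≤ g.roots.toFinset.card * (M - 1) := by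
        simpa using Finset.sum_le_card_nsmul _ _ _ hcount
    _ ≤ k * (M - 1) := by
        gcongr
        omega
end

section
/- For all integers m ≥ 2 and n ≥ 2, the number of distinct complex roots of the polynomial 1 − t^{m+1} − t^{n+1} + t^{n+m} is at least (n+m)/3. -/
open Polynomial

/-- The Euler operator `f ↦ X f'` lowers the order of vanishing by at most one. -/
theorem pow_dvd_X_mul_derivative {R : Type*} [CommRing R] {p f : R[X]} {k : ℕ}
    (h : p ^ (k + 1) ∣ f) : p ^ k ∣ X * derivative f :=
  (pow_sub_one_dvd_derivative_of_pow_dvd h).mul_left X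

theorem X_mul_derivative_X_pow {R : Type*} [CommRing R] (k : ℕ) :
    X * derivative (X ^ k : R[X]) = C (k : R) * X ^ k := by
  cases k with
  | zero => simp
  | succ k => rw [derivative_X_pow, Nat.add_sub_cancel]; ring

theorem X_mul_derivative_C_mul {R : Type*} [CommRing R] (a : R) (f : R[X]) :
    X * derivative (C a * f) = C a * (X * derivative f) := by
  rw [derivative_C_mul]; ring

/-- Every root of `1 − t^{m+1} − t^{n+1} + t^{n+m}` has multiplicity at most three. -/
theorem rootMultiplicity_torus_knot_le (m n : ℕ) (hm : 2 ≤ m) (hn : 2 ≤ n) (z : ℂ) :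
    (1 - X ^ (m + 1) - X ^ (n + 1) + X ^ (n + m) : ℂ[X]).rootMultiplicity z ≤ 3 := by
  by_contra! h
  have h4 : (X - C z) ^ 4 ∣ (1 - X ^ (m + 1) - X ^ (n + 1) + X ^ (n + m) : ℂ[X]) :=
    (pow_dvd_pow _ h).trans (pow_rootMultiplicity_dvd _ z)
  have h3 := pow_dvd_X_mul_derivative h4
  have h2 := pow_dvd_X_mul_derivative h3
  have h1 := pow_dvd_X_mul_derivative h2
  have e0 := dvd_iff_isRoot.1 ((dvd_pow_self _ (by norm_num)).trans h4)
  have e1 := dvd_iff_isRoot.1 ((dvd_pow_self _ (by norm_num)).trans h3)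
  have e2 := dvd_iff_isRoot.1 ((dvd_pow_self _ (by norm_num)).trans h2)
  have e3 := dvd_iff_isRoot.1 ((dvd_pow_self _ (by norm_num)).trans h1)
  simp only [derivative_add, derivative_sub, mul_add, mul_sub, derivative_one, zero_sub,
    derivative_neg, mul_neg, X_mul_derivative_C_mul, X_mul_derivative_X_pow, IsRoot.def, eval_add,
    eval_sub, eval_neg, eval_mul, eval_C, eval_pow, eval_X, eval_one, Nat.cast_add,
    Nat.cast_one] at e0 e1 e2 e3
  have key : ((n : ℂ) + m) * (n - 1) * (m - 1) * z ^ (n + m) = 0 := by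
    linear_combination e3 - ((m : ℂ) + 1 + (n + 1)) * e2 + ((m : ℂ) + 1) * (n + 1) * e1
  have hnm : (n : ℂ) + m ≠ 0 := by exact_mod_cast (by lia : n + m ≠ 0)
  have hn1 : (n : ℂ) - 1 ≠ 0 := sub_ne_zero.2 (by exact_mod_cast (by lia : n ≠ 1))
  have hm1 : (m : ℂ) - 1 ≠ 0 := sub_ne_zero.2 (by exact_mod_cast (by lia : m ≠ 1))
  have hz : z = 0 :=
    eq_zero_of_pow_eq_zero ((mul_eq_zero.1 key).resolve_left
      (mul_ne_zero (mul_ne_zero hnm hn1) hm1))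
  subst hz
  simp [zero_pow (show n + m ≠ 0 by lia)] at e0

theorem natDegree_torus_knot (m n : ℕ) (hm : 2 ≤ m) (hn : 2 ≤ n) :
    (1 - X ^ (m + 1) - X ^ (n + 1) + X ^ (n + m) : ℂ[X]).natDegree = n + m := by
  have h1 : n + m ≠ m + 1 := by lia
  have h2 : n + m ≠ n + 1 := by lia
  have h0 : n + m ≠ 0 := by lia
  refine natDegree_eq_of_le_of_coeff_ne_zero ?_ ?_
  · compute_degree
    lia
  · simp only [coeff_add, coeff_sub, coeff_X_pow, coeff_one, if_neg h0, if_neg h1, if_neg h2]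
    simp

/-- For `m, n ≥ 2`, the polynomial `1 − t^{m+1} − t^{n+1} + t^{n+m}` has at least
`(n+m)/3` distinct complex roots. -/
theorem distinct_roots_torus_knot_lower_bound (m n : ℕ) (hm : 2 ≤ m) (hn : 2 ≤ n) :
    ((n + m : ℕ) : ℝ) / 3 ≤
      (((1 - X ^ (m + 1) - X ^ (n + 1) + X ^ (n + m) : Polynomial ℤ).map
          (Int.castRingHom ℂ)).roots.toFinset.card : ℝ) := by
  simp only [Polynomial.map_add, Polynomial.map_sub, Polynomial.map_pow, map_X, Polynomial.map_one]
  rw [div_le_iff₀ (by norm_num)]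
  have hcard := IsAlgClosed.card_roots_eq_natDegree
    (p := (1 - X ^ (m + 1) - X ^ (n + 1) + X ^ (n + m) : ℂ[X]))
  rw [natDegree_torus_knot m n hm hn, ← Multiset.toFinset_sum_count_eq] at hcard
  have := Finset.sum_le_card_nsmul _ _ 3 fun z
      (_ : z ∈ (1 - X ^ (m + 1) - X ^ (n + 1) + X ^ (n + m) : ℂ[X]).roots.toFinset) =>
    (count_roots (a := z) _).trans_le (rootMultiplicity_torus_knot_le m n hm hn z)
  rw [hcard, smul_eq_mul] at this
  exact_mod_cast this
end

section
/- For every integer m ≥ 1, the number of distinct complex roots of the polynomial 1 − t³ + t^{2m+1} + t^{2m+3} is at least (2m+3)/3. In particular, the number of distinct roots tends to infinity as m → ∞. -/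
open Polynomial

/-- Every complex root of `1 − t³ + t^{2k+3} + t^{2k+5}` has multiplicity at most `3`. -/
lemma rootMultiplicity_quadrinomial_le_three (k : ℕ) (r : ℂ) :
    (1 - X ^ 3 + X ^ (2 * k + 3) + X ^ (2 * k + 5) : ℂ[X]).rootMultiplicity r ≤ 3 := by
  by_contra! h
  have h0 := isRoot_iterate_derivative_of_lt_rootMultiplicity (n := 0) (h.trans' (by norm_num)) |>.eq_zero
  have h1 := isRoot_iterate_derivative_of_lt_rootMultiplicity (n := 1) (h.trans' (by norm_num)) |>.eq_zero
  have h2 := isRoot_iterate_derivative_of_lt_rootMultiplicity (n := 2) (h.trans' (by norm_num)) |>.eq_zero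
  have h3 := isRoot_iterate_derivative_of_lt_rootMultiplicity (n := 3) h |>.eq_zero
  have hr : r ≠ 0 := by
    rintro rfl
    simp at h0
  simp at h1 h2 h3
  have key : 2 * ((2 * k + 5 : ℕ) : ℂ) * ((2 * k + 2 : ℕ) : ℂ) * (r ^ (2 * k) * r ^ 4) = 0 := by
    push_cast
    linear_combination r ^ 2 * h3 - 2 * h1 - (2 * k + 3) * (r * h2 - 2 * h1)
  have hk5 : ((2 * k + 5 : ℕ) : ℂ) ≠ 0 := Nat.cast_ne_zero.2 (by lia)
  have hk2 : ((2 * k + 2 : ℕ) : ℂ) ≠ 0 := Nat.cast_ne_zero.2 (by lia)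
  simp_all only [mul_eq_zero, pow_eq_zero_iff', OfNat.ofNat_ne_zero, ne_eq, false_and, or_self]

/-- For every `m ≥ 1`, the polynomial `1 − t³ + t^{2m+1} + t^{2m+3}` has at least
`(2m+3)/3` distinct complex roots; in particular the number of distinct roots tends to
infinity as `m → ∞`. -/
theorem distinct_roots_twist_knot_lower_bound (m : ℕ) (hm : 1 ≤ m) :
    ((2 * m + 3 : ℕ) : ℝ) / 3 ≤
      (((1 - X ^ 3 + X ^ (2 * m + 1) + X ^ (2 * m + 3) : Polynomial ℤ).map
          (Int.castRingHom ℂ)).roots.toFinset.card : ℝ) := by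
  obtain ⟨k, rfl⟩ := Nat.exists_eq_add_of_le' hm
  have hmap : ((1 - X ^ 3 + X ^ (2 * (k + 1) + 1) + X ^ (2 * (k + 1) + 3) : ℤ[X]).map
      (Int.castRingHom ℂ)) = 1 - X ^ 3 + X ^ (2 * k + 3) + X ^ (2 * k + 5) := by
    simp [mul_add, add_assoc]
  rw [hmap]
  set p : ℂ[X] := 1 - X ^ 3 + X ^ (2 * k + 3) + X ^ (2 * k + 5) with hp
  have hdeg : p.natDegree = 2 * k + 5 := by
    rw [hp]
    compute_degree
    · simp
    all_goals lia
  have hcard : p.roots.card = 2 * k + 5 := by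
    rw [← (IsAlgClosed.splits p).natDegree_eq_card_roots, hdeg]
  have hle : 2 * k + 5 ≤ p.roots.toFinset.card * 3 := by
    rw [← hcard, ← Multiset.toFinset_sum_count_eq, ← smul_eq_mul]
    refine Finset.sum_le_card_nsmul _ _ _ fun r _ => ?_
    rw [count_roots]
    exact rootMultiplicity_quadrinomial_le_three k r
  rw [div_le_iff₀ (by norm_num)]
  exact_mod_cast (by lia : 2 * (k + 1) + 3 ≤ p.roots.toFinset.card * 3)
end
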